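/- Assume 0 ≤ γ < 1 and let V_π : S → ℝ be the unique solution of the Bellman equation for π; define the true advantage A_π(a,s₀) = r(s₀,a) + γ·Σ_{s'} P(s'|s₀,a)·V_π(s') − V_π(s₀). Then for every action a and every function V̂ : S → ℝ used in the estimators, the squared bias of the δHCA estimator equals that of the Monte-Carlo estimator: (E_π[Â^δHCA_N(a)|S_0=s] − A_π(a,s))² = (E_π[Â^MC_N(a)|S_0=s] − A_π(a,s))². -/

import Mathlib

open Finset

attribute [local instance] Classical.propDecidable

namespace HCA

/-- A trajectory of horizon `N`: the actions taken at steps `0, …, N-1` and the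
states reached after each step (the start state is fixed separately). -/
abbrev Traj (S A : Type*) (N : ℕ) : Type _ := (Fin N → A) × (Fin N → S)

variable {S A : Type*} [Fintype S] [Fintype A] [Nonempty S] [Nonempty A]

/-- The state `S_k` of a trajectory with start state `s`. -/
def st {N : ℕ} (s : S) (τ : Traj S A N) : ℕ → S
  | 0 => s
  | k + 1 => if h : k < N then τ.2 ⟨k, h⟩ else s

/-- The action `A_k` of a trajectory. -/
noncomputable def ac {N : ℕ} (τ : Traj S A N) (k : ℕ) : A :=
  if h : k < N then τ.1 ⟨k, h⟩ else Classical.arbitrary A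

/-- The probability `P_π(τ) = ∏_{k=0}^{N-1} π(A_k|S_k)·P(S_{k+1}|S_k,A_k)` of a
trajectory starting at `s`. -/
noncomputable def trajP (π : S → A → ℝ) (P : S → A → S → ℝ) (s : S) (N : ℕ)
    (τ : Traj S A N) : ℝ :=
  ∏ k : Fin N, π (st s τ k) (τ.1 k) * P (st s τ k) (τ.1 k) (st s τ (k + 1))

/-- Expectation `E_π[f | S_0 = s]` over trajectories. -/
noncomputable def expct (π : S → A → ℝ) (P : S → A → S → ℝ) (s : S) (N : ℕ)
    (f : Traj S A N → ℝ) : ℝ :=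
  ∑ τ : Traj S A N, trajP π P s N τ * f τ

/-- Variance `Var_π(f | S_0 = s)` over trajectories. -/
noncomputable def vr (π : S → A → ℝ) (P : S → A → S → ℝ) (s : S) (N : ℕ)
    (f : Traj S A N → ℝ) : ℝ :=
  expct π P s N (fun τ => (f τ - expct π P s N f) ^ 2)

/-- Covariance `cov_π(f, g | S_0 = s)` over trajectories. -/
noncomputable def cv (π : S → A → ℝ) (P : S → A → S → ℝ) (s : S) (N : ℕ)
    (f g : Traj S A N → ℝ) : ℝ :=
  expct π P s N (fun τ => (f τ - expct π P s N f) * (g τ - expct π P s N g))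

/-- Probability `P_π(E | S_0 = s)` of an event `E` on trajectories. -/
noncomputable def prE (π : S → A → ℝ) (P : S → A → S → ℝ) (s : S) (N : ℕ)
    (E : Traj S A N → Prop) : ℝ :=
  ∑ τ : Traj S A N, if E τ then trajP π P s N τ else 0

/-- The TD error `δ_k = r(S_k,A_k) + γ·V̂(S_{k+1}) − V̂(S_k)`. -/
noncomputable def td (r : S → A → ℝ) (γ : ℝ) (V : S → ℝ) (s : S) {N : ℕ}
    (τ : Traj S A N) (k : ℕ) : ℝ :=
  r (st s τ k) (ac τ k) + γ * V (st s τ (k + 1)) - V (st s τ k)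

/-- `p_k(s'|s,a) = P_π(S_k = s' | S_0 = s, A_0 = a)
  = P_π(A_0 = a, S_k = s' | S_0 = s) / π(a|s)`. -/
noncomputable def pkSA (π : S → A → ℝ) (P : S → A → S → ℝ) (s : S) (N k : ℕ)
    (a : A) (s' : S) : ℝ :=
  prE π P s N (fun τ => ac τ 0 = a ∧ st s τ k = s') / π s a

/-- `p_k(s'|s) = Σ_a π(a|s)·p_k(s'|s,a)`. -/
noncomputable def pkS (π : S → A → ℝ) (P : S → A → S → ℝ) (s : S) (N k : ℕ)
    (s' : S) : ℝ :=
  ∑ a : A, π s a * pkSA π P s N k a s'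

/-- The hindsight probability `p_k(a|s,s')`, defined as
`P_π(A_0 = a, S_k = s' | S_0 = s)/p_k(s'|s)` when `p_k(s'|s) > 0` and `0` otherwise. -/
noncomputable def pkA (π : S → A → ℝ) (P : S → A → S → ℝ) (s : S) (N k : ℕ)
    (a : A) (s' : S) : ℝ :=
  if 0 < pkS π P s N k s' then
    prE π P s N (fun τ => ac τ 0 = a ∧ st s τ k = s') / pkS π P s N k s'
  else 0

/-- The `N`-step Monte-Carlo advantage estimator
`Â^MC_N(a) = (1(A_0=a)/π(a|s))·Σ_{k=0}^{N−1} γ^k·δ_k`. -/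
noncomputable def mcEst (π : S → A → ℝ) (r : S → A → ℝ) (γ : ℝ) (V : S → ℝ)
    (s : S) (N : ℕ) (a : A) (τ : Traj S A N) : ℝ :=
  ((if ac τ 0 = a then (1 : ℝ) else 0) / π s a) * ∑ k ∈ range N, γ ^ k * td r γ V s τ k

/-- The `N`-step δHCA advantage estimator
`Â^δHCA_N(a) = (1(A_0=a)/π(a|s))·δ_0 + Σ_{k=1}^{N−1} γ^k·(p_k(a|s,S_k)/π(a|s))·δ_k`. -/
noncomputable def dhcaEst (π : S → A → ℝ) (P : S → A → S → ℝ) (r : S → A → ℝ)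
    (γ : ℝ) (V : S → ℝ) (s : S) (N : ℕ) (a : A) (τ : Traj S A N) : ℝ :=
  ((if ac τ 0 = a then (1 : ℝ) else 0) / π s a) * td r γ V s τ 0
    + ∑ k ∈ Ico 1 N, γ ^ k * (pkA π P s N k a (st s τ k) / π s a) * td r γ V s τ k

/-- `V` satisfies the Bellman equation for `π`:
`V(s₀) = Σ_a π(a|s₀)·(r(s₀,a) + γ·Σ_{s'} P(s'|s₀,a)·V(s'))` for every state `s₀`. -/
def IsBellman (π : S → A → ℝ) (P : S → A → S → ℝ) (r : S → A → ℝ) (γ : ℝ)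
    (V : S → ℝ) : Prop :=
  ∀ s₀ : S, V s₀ = ∑ a : A, π s₀ a * (r s₀ a + γ * ∑ s' : S, P s₀ a s' * V s')

/-- The conditional second moment `E_π[δ_k² | S_0 = s, S_k = s']`,
defined as `(Σ_{τ : S_k = s'} P_π(τ)·δ_k(τ)²)/p_k(s'|s)`. -/
noncomputable def sndMom (π : S → A → ℝ) (P : S → A → S → ℝ) (r : S → A → ℝ)
    (γ : ℝ) (V : S → ℝ) (s : S) (N k : ℕ) (s' : S) : ℝ :=
  (∑ τ : Traj S A N, if st s τ k = s' then trajP π P s N τ * (td r γ V s τ k) ^ 2 else 0)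
    / pkS π P s N k s'

/-- Prepend a first step to a trajectory. -/
def consT {S A : Type*} {N : ℕ} (a : A) (x : S) (τ : Traj S A N) : Traj S A (N + 1) :=
  (Fin.cons a τ.1, Fin.cons x τ.2)

/-- Decomposition of a trajectory into its first step and the rest. -/
def consE (S A : Type*) (N : ℕ) : (A × S) × Traj S A N ≃ Traj S A (N + 1) where
  toFun p := consT p.1.1 p.1.2 p.2
  invFun τ := ((τ.1 0, τ.2 0), (Fin.tail τ.1, Fin.tail τ.2))
  left_inv p := by simp [consT]
  right_inv τ := by simp [consT]

theorem st_cons {S A : Type*} {N : ℕ} (s : S) (a : A) (x : S) (τ : Traj S A N) (k : ℕ)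
    (hk : k ≤ N) : st s (consT a x τ) (k + 1) = st x τ k := by
  cases k with
  | zero => simp [st, consT]
  | succ k =>
    have h1 : k < N := hk
    have h2 : k + 1 < N + 1 := by omega
    simp only [st, h1, h2, dif_pos, consT]
    exact Fin.cons_succ (α := fun _ => S) x τ.2 ⟨k, h1⟩

theorem ac_cons {S A : Type*} [Nonempty A] {N : ℕ} (a : A) (x : S) (τ : Traj S A N)
    (k : ℕ) (hk : k < N) : ac (consT a x τ) (k + 1) = ac τ k := by
  have h2 : k + 1 < N + 1 := by omega
  simp only [ac, hk, h2, dif_pos, consT]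
  exact Fin.cons_succ (α := fun _ => A) a τ.1 ⟨k, hk⟩

theorem ac_cons_zero {S A : Type*} [Nonempty A] {N : ℕ} (a : A) (x : S) (τ : Traj S A N) :
    ac (consT a x τ) 0 = a := by
  simp [ac, consT]

theorem td_cons {S A : Type*} [Nonempty A] {N : ℕ} (r : S → A → ℝ) (γ : ℝ) (V : S → ℝ)
    (s : S) (a : A) (x : S) (τ : Traj S A N)
    (k : ℕ) (hk : k < N) : td r γ V s (consT a x τ) (k + 1) = td r γ V x τ k := by
  simp only [td]
  rw [ac_cons _ _ _ _ hk, st_cons _ _ _ _ _ hk.le, st_cons _ _ _ _ _ hk]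

theorem trajP_cons {S A : Type*} {N : ℕ} (π : S → A → ℝ) (P : S → A → S → ℝ)
    (s : S) (a : A) (x : S) (τ : Traj S A N) :
    trajP π P s (N + 1) (consT a x τ) = π s a * P s a x * trajP π P x N τ := by
  unfold trajP
  rw [Fin.prod_univ_succ]
  refine congrArg₂ (· * ·) ?_ ?_
  · simp [st, consT]
  · apply Finset.prod_congr rfl
    intro k _
    have h1 : st s (consT a x τ) (k.succ : Fin (N + 1)) = st x τ k := by
      rw [Fin.val_succ]; exact st_cons _ _ _ _ _ k.2.le
    have h2 : st s (consT a x τ) ((k.succ : Fin (N + 1)) + 1) = st x τ (k + 1) := by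
      rw [Fin.val_succ]; exact st_cons _ _ _ _ _ k.2
    have h3 : (consT a x τ).1 k.succ = τ.1 k := by simp [consT]
    rw [h1, h2, h3]

theorem expct_succ {S A : Type*} [Fintype S] [Fintype A] {N : ℕ} (π : S → A → ℝ)
    (P : S → A → S → ℝ) (s : S) (f : Traj S A (N + 1) → ℝ) :
    expct π P s (N + 1) f
      = ∑ a, ∑ x, π s a * P s a x * expct π P x N (fun τ => f (consT a x τ)) := by
  unfold expct
  rw [← Equiv.sum_comp (consE S A N), Fintype.sum_prod_type, Fintype.sum_prod_type]
  refine Finset.sum_congr rfl fun a _ => Finset.sum_congr rfl fun x _ => ?_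
  rw [Finset.mul_sum]
  refine Finset.sum_congr rfl fun τ _ => ?_
  change trajP π P s (N + 1) (consT a x τ) * f (consT a x τ) = _
  rw [trajP_cons]; ring

theorem expct_const {S A : Type*} [Fintype S] [Fintype A] (π : S → A → ℝ)
    (P : S → A → S → ℝ) (hπsum : ∀ s₀ : S, ∑ a : A, π s₀ a = 1)
    (hPsum : ∀ (s₀ : S) (a : A), ∑ s' : S, P s₀ a s' = 1) (N : ℕ) (s : S) (c : ℝ) :
    expct π P s N (fun _ => c) = c := by
  induction N generalizing s with
  | zero => simp [expct, trajP]
  | succ N ih =>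
    rw [expct_succ]
    simp only [ih, ← Finset.sum_mul, ← Finset.mul_sum, hPsum, hπsum, mul_one, one_mul]

/-- Conditional mean of the TD error given the current state. -/
noncomputable def hmean {S A : Type*} [Fintype S] [Fintype A] (π : S → A → ℝ)
    (P : S → A → S → ℝ) (r : S → A → ℝ) (γ : ℝ) (V : S → ℝ) (y : S) : ℝ :=
  ∑ a, ∑ x, π y a * P y a x * (r y a + γ * V x - V y)

theorem markov {S A : Type*} [Fintype S] [Fintype A] [Nonempty A] (π : S → A → ℝ)
    (P : S → A → S → ℝ) (r : S → A → ℝ) (γ : ℝ) (V : S → ℝ)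
    (hπsum : ∀ s₀ : S, ∑ a : A, π s₀ a = 1)
    (hPsum : ∀ (s₀ : S) (a : A), ∑ s' : S, P s₀ a s' = 1) (g : S → ℝ)
    (k N : ℕ) (hk : k < N) (s : S) :
    expct π P s N (fun τ => g (st s τ k) * td r γ V s τ k)
      = expct π P s N (fun τ => g (st s τ k) * hmean π P r γ V (st s τ k)) := by
  induction k generalizing s N with
  | zero =>
    obtain ⟨n, rfl⟩ : ∃ n, N = n + 1 := ⟨N - 1, by omega⟩
    have e : (fun τ : Traj S A (n + 1) => g (st s τ 0) * hmean π P r γ V (st s τ 0))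
      = fun _ => g s * hmean π P r γ V s := rfl
    rw [e, expct_const π P hπsum hPsum, expct_succ, hmean, Finset.mul_sum]
    refine Finset.sum_congr rfl fun a _ => ?_
    rw [Finset.mul_sum]
    refine Finset.sum_congr rfl fun x _ => ?_
    have e2 : (fun τ : Traj S A n => g (st s (consT a x τ) 0) * td r γ V s (consT a x τ) 0)
      = fun _ => g s * (r s a + γ * V x - V s) := by
      funext τ
      simp only [td, ac_cons_zero, st_cons _ _ _ _ _ (Nat.zero_le n)]
      rfl
    rw [e2, expct_const π P hπsum hPsum]; ring
  | succ k ih =>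
    obtain ⟨n, rfl⟩ : ∃ n, N = n + 1 := ⟨N - 1, by omega⟩
    have hk' : k < n := by omega
    rw [expct_succ, expct_succ]
    refine Finset.sum_congr rfl fun a _ => Finset.sum_congr rfl fun x _ => ?_
    simp only [td_cons _ _ _ _ _ _ _ _ hk', st_cons _ _ _ _ _ hk'.le]
    rw [ih n hk' x]

theorem markov' {S A : Type*} [Fintype S] [Fintype A] [Nonempty A] (π : S → A → ℝ)
    (P : S → A → S → ℝ) (r : S → A → ℝ) (γ : ℝ) (V : S → ℝ)
    (hπsum : ∀ s₀ : S, ∑ a : A, π s₀ a = 1)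
    (hPsum : ∀ (s₀ : S) (a : A), ∑ s' : S, P s₀ a s' = 1) (g : A → ℝ)
    (k N : ℕ) (hk1 : 1 ≤ k) (hk : k < N) (s : S) :
    expct π P s N (fun τ => g (ac τ 0) * td r γ V s τ k)
      = expct π P s N (fun τ => g (ac τ 0) * hmean π P r γ V (st s τ k)) := by
  obtain ⟨n, rfl⟩ : ∃ n, N = n + 1 := ⟨N - 1, by omega⟩
  obtain ⟨k, rfl⟩ : ∃ j, k = j + 1 := ⟨k - 1, by omega⟩
  have hk' : k < n := by omega
  rw [expct_succ, expct_succ]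
  refine Finset.sum_congr rfl fun a _ => Finset.sum_congr rfl fun x _ => ?_
  simp only [td_cons _ _ _ _ _ _ _ _ hk', st_cons _ _ _ _ _ hk'.le, ac_cons_zero]
  rw [markov π P r γ V hπsum hPsum (fun _ => g a) k n hk' x]

theorem prE_nonneg {S A : Type*} [Fintype S] [Fintype A] (π : S → A → ℝ)
    (P : S → A → S → ℝ) (hπpos : ∀ s₀ a, 0 < π s₀ a) (hPnn : ∀ s₀ a s', 0 ≤ P s₀ a s')
    (s : S) (N : ℕ) (E : Traj S A N → Prop) : 0 ≤ prE π P s N E := by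
  unfold prE
  refine Finset.sum_nonneg fun τ _ => ?_
  split_ifs
  · exact Finset.prod_nonneg fun k _ => mul_nonneg (hπpos _ _).le (hPnn _ _ _)
  · exact le_rfl

theorem pkS_eq {S A : Type*} [Fintype S] [Fintype A] [Nonempty A] (π : S → A → ℝ)
    (P : S → A → S → ℝ) (hπpos : ∀ s₀ a, 0 < π s₀ a)
    (s : S) (N k : ℕ) (y : S) :
    pkS π P s N k y = ∑ a, prE π P s N (fun τ => ac τ 0 = a ∧ st s τ k = y) := by
  unfold pkS pkSA
  refine Finset.sum_congr rfl fun a _ => ?_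
  have := (hπpos s a).ne'
  field_simp

theorem pkS_eq' {S A : Type*} [Fintype S] [Fintype A] [Nonempty A] (π : S → A → ℝ)
    (P : S → A → S → ℝ) (hπpos : ∀ s₀ a, 0 < π s₀ a)
    (s : S) (N k : ℕ) (y : S) :
    pkS π P s N k y = prE π P s N (fun τ => st s τ k = y) := by
  rw [pkS_eq π P hπpos]
  unfold prE
  rw [Finset.sum_comm]
  refine Finset.sum_congr rfl fun τ _ => ?_
  by_cases h : st s τ k = y <;> simp [h]

theorem pkS_mul_pkA {S A : Type*} [Fintype S] [Fintype A] [Nonempty A] (π : S → A → ℝ)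
    (P : S → A → S → ℝ) (hπpos : ∀ s₀ a, 0 < π s₀ a) (hPnn : ∀ s₀ a s', 0 ≤ P s₀ a s')
    (s : S) (N k : ℕ) (a : A) (y : S) :
    pkS π P s N k y * pkA π P s N k a y
      = prE π P s N (fun τ => ac τ 0 = a ∧ st s τ k = y) := by
  unfold pkA
  split_ifs with h
  · field_simp
  · have h1 : prE π P s N (fun τ => ac τ 0 = a ∧ st s τ k = y) ≤ pkS π P s N k y := by
      rw [pkS_eq π P hπpos]
      exact Finset.single_le_sum
        (f := fun a => prE π P s N (fun τ => ac τ 0 = a ∧ st s τ k = y))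
        (fun b _ => prE_nonneg π P hπpos hPnn s N _) (Finset.mem_univ a)
    have h2 := prE_nonneg π P hπpos hPnn s N (fun τ => ac τ 0 = a ∧ st s τ k = y)
    linarith

theorem expct_state {S A : Type*} [Fintype S] [Fintype A] (π : S → A → ℝ)
    (P : S → A → S → ℝ) (s : S) (N k : ℕ) (E : Traj S A N → Prop) (f : S → ℝ) :
    expct π P s N (fun τ => (if E τ then (1 : ℝ) else 0) * f (st s τ k))
      = ∑ y, prE π P s N (fun τ => E τ ∧ st s τ k = y) * f y := by
  unfold expct prE
  simp only [Finset.sum_mul]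
  rw [Finset.sum_comm]
  refine Finset.sum_congr rfl fun τ _ => ?_
  by_cases h : E τ <;> simp [h]

theorem term_eq {S A : Type*} [Fintype S] [Fintype A] [Nonempty A] (π : S → A → ℝ)
    (P : S → A → S → ℝ) (r : S → A → ℝ) (γ : ℝ) (V : S → ℝ)
    (hπpos : ∀ s₀ a, 0 < π s₀ a) (hPnn : ∀ s₀ a s', 0 ≤ P s₀ a s')
    (hπsum : ∀ s₀ : S, ∑ a : A, π s₀ a = 1)
    (hPsum : ∀ (s₀ : S) (a : A), ∑ s' : S, P s₀ a s' = 1)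
    (k N : ℕ) (hk1 : 1 ≤ k) (hk : k < N) (s : S) (a : A) :
    expct π P s N (fun τ => pkA π P s N k a (st s τ k) * td r γ V s τ k)
      = expct π P s N (fun τ => (if ac τ 0 = a then (1 : ℝ) else 0) * td r γ V s τ k) := by
  rw [markov π P r γ V hπsum hPsum (fun y => pkA π P s N k a y) k N hk s,
    markov' π P r γ V hπsum hPsum (fun b => if b = a then (1 : ℝ) else 0) k N hk1 hk s,
    expct_state π P s N k (fun τ => ac τ 0 = a) (hmean π P r γ V)]
  have := expct_state π P s N k (fun _ => True)
    (fun y => pkA π P s N k a y * hmean π P r γ V y)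
  simp only [if_true, one_mul, true_and] at this
  rw [this]
  refine Finset.sum_congr rfl fun y _ => ?_
  rw [← pkS_mul_pkA π P hπpos hPnn, pkS_eq' π P hπpos]
  ring

theorem expct_add {S A : Type*} [Fintype S] [Fintype A] (π : S → A → ℝ)
    (P : S → A → S → ℝ) (s : S) (N : ℕ) (f g : Traj S A N → ℝ) :
    expct π P s N (fun τ => f τ + g τ) = expct π P s N f + expct π P s N g := by
  simp [expct, mul_add, Finset.sum_add_distrib]

theorem expct_smul {S A : Type*} [Fintype S] [Fintype A] (π : S → A → ℝ)
    (P : S → A → S → ℝ) (s : S) (N : ℕ) (c : ℝ) (f : Traj S A N → ℝ) :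
    expct π P s N (fun τ => c * f τ) = c * expct π P s N f := by
  simp only [expct, Finset.mul_sum]
  exact Finset.sum_congr rfl fun τ _ => by ring

theorem expct_sum {S A : Type*} [Fintype S] [Fintype A] (π : S → A → ℝ)
    (P : S → A → S → ℝ) (s : S) (N : ℕ) (I : Finset ℕ) (f : ℕ → Traj S A N → ℝ) :
    expct π P s N (fun τ => ∑ k ∈ I, f k τ) = ∑ k ∈ I, expct π P s N (f k) := by
  simp only [expct, Finset.mul_sum]
  exact Finset.sum_comm

theorem expct_eq {S A : Type*} [Fintype S] [Fintype A] [Nonempty A] (π : S → A → ℝ)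
    (P : S → A → S → ℝ) (r : S → A → ℝ) (γ : ℝ) (V : S → ℝ)
    (hπpos : ∀ s₀ a, 0 < π s₀ a) (hPnn : ∀ s₀ a s', 0 ≤ P s₀ a s')
    (hπsum : ∀ s₀ : S, ∑ a : A, π s₀ a = 1)
    (hPsum : ∀ (s₀ : S) (a : A), ∑ s' : S, P s₀ a s' = 1)
    (N : ℕ) (hN : 1 ≤ N) (s : S) (a : A) :
    expct π P s N (dhcaEst π P r γ V s N a) = expct π P s N (mcEst π r γ V s N a) := by
  have e1 : dhcaEst π P r γ V s N a = fun τ =>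
      ((if ac τ 0 = a then (1 : ℝ) else 0) / π s a) * td r γ V s τ 0
      + ∑ k ∈ Ico 1 N, (γ ^ k / π s a) * (pkA π P s N k a (st s τ k) * td r γ V s τ k) := by
    funext τ
    unfold dhcaEst
    congr 1
    exact Finset.sum_congr rfl fun k _ => by ring
  have e2 : mcEst π r γ V s N a = fun τ =>
      ((if ac τ 0 = a then (1 : ℝ) else 0) / π s a) * td r γ V s τ 0
      + ∑ k ∈ Ico 1 N, (γ ^ k / π s a) *
        ((if ac τ 0 = a then (1 : ℝ) else 0) * td r γ V s τ k) := by
    funext τ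
    unfold mcEst
    rw [Finset.range_eq_Ico, Finset.sum_eq_sum_Ico_succ_bot (by omega), mul_add, Finset.mul_sum]
    congr 1
    · simp
    · exact Finset.sum_congr rfl fun k _ => by ring
  rw [e1, e2, expct_add, expct_add, expct_sum, expct_sum]
  congr 1
  refine Finset.sum_congr rfl fun k hk => ?_
  rw [Finset.mem_Ico] at hk
  rw [expct_smul, expct_smul, term_eq π P r γ V hπpos hPnn hπsum hPsum k N hk.1 hk.2 s a]

theorem stmt_1 {S A : Type*} [Fintype S] [Fintype A] [Nonempty S] [Nonempty A]
    (π : S → A → ℝ) (P : S → A → S → ℝ) (r : S → A → ℝ) (γ : ℝ)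
    (N : ℕ) (s : S)
    (hπpos : ∀ s₀ a, 0 < π s₀ a) (hπsum : ∀ s₀ : S, ∑ a : A, π s₀ a = 1)
    (hPnn : ∀ s₀ a s', 0 ≤ P s₀ a s') (hPsum : ∀ (s₀ : S) (a : A), ∑ s' : S, P s₀ a s' = 1)
    (hγ0 : 0 ≤ γ) (hγ1 : γ ≤ 1) (hN : 1 ≤ N)
    (hγlt : γ < 1) (Vπ : S → ℝ) (hVπ : IsBellman π P r γ Vπ)
    (hVπuniq : ∀ V : S → ℝ, IsBellman π P r γ V → V = Vπ) :
    ∀ (a : A) (V : S → ℝ),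
      (expct π P s N (dhcaEst π P r γ V s N a)
          - (r s a + γ * ∑ s' : S, P s a s' * Vπ s' - Vπ s)) ^ 2
        = (expct π P s N (mcEst π r γ V s N a)
          - (r s a + γ * ∑ s' : S, P s a s' * Vπ s' - Vπ s)) ^ 2 := by
  intro a V
  rw [expct_eq π P r γ V hπpos hPnn hπsum hPsum N hN s a]

end HCA
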